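/- arXiv:1406.1108 — 8 statements merged into one kernel-verified Lean document; each statement's English description precedes it below -/
import Mathlib

section
/- Let φ ∈ S be such that there is L < ∞ with ‖φ(·,ω)‖_Lip ≤ L (Lipschitz with respect to the ℓ¹ distance on ℤ^d) for P-almost every ω. For each ω let μ(x,t,ω) denote the finite time-horizon value function with edge-weights τ(·,·,ω), running cost p·α, and terminal cost φ(·,ω). If c ∈ ℝ is such that μ(0,t,ω)/t → −c as t → ∞ for P-almost every ω, then c ≤ esssup_{ω∈Ω} sup_{x∈ℤ^d} 𝓗(φ,p,x,ω). (This is the upper-bound half of the discrete variational formula for the effective Hamiltonian of first-passage percolation.) -/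
open MeasureTheory Filter

noncomputable section

/-- The set `A` of signed standard basis vectors of `ℤ^d`. -/
def dirs (d : ℕ) : Finset (Fin d → ℤ) :=
  Finset.univ.image (fun ib : Fin d × Bool =>
    if ib.2 then Pi.single ib.1 1 else -Pi.single ib.1 1)

/-- The inner product `p·α` of `p ∈ ℝ^d` with a lattice vector `α ∈ ℤ^d`. -/
def pdot {d : ℕ} (p : Fin d → ℝ) (α : Fin d → ℤ) : ℝ := ∑ i, p i * (α i : ℝ)

/-- The `ℓ∞` norm of `p ∈ ℝ^d`. -/
def linf {d : ℕ} (p : Fin d → ℝ) : ℝ := ⨆ i, |p i|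

/-- The `ℓ¹` norm of a lattice point. -/
def zl1 {d : ℕ} (x : Fin d → ℤ) : ℝ := ∑ i, |(x i : ℝ)|

/-- The discrete Hamiltonian `𝓗(φ,p,x) = max_{α∈A} (−𝒟φ(x,α) − p·α)/τ(x,α)`. -/
def ham {d : ℕ} (τ : (Fin d → ℤ) → (Fin d → ℤ) → ℝ) (p : Fin d → ℝ)
    (φ : (Fin d → ℤ) → ℝ) (x : Fin d → ℤ) : ℝ :=
  sSup {r : ℝ | ∃ α ∈ dirs d, r = (-(φ (x + α) - φ x) - pdot p α) / τ x α}

/-- `v` is a nearest-neighbor path of length `k` starting at `x`. -/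
def IsPath {d : ℕ} (x : Fin d → ℤ) (k : ℕ) (v : ℕ → Fin d → ℤ) : Prop :=
  v 0 = x ∧ ∀ i < k, v (i + 1) - v i ∈ dirs d

/-- Total weight (travel time) of the first `k` steps of a path. -/
def pathWeight {d : ℕ} (τ : (Fin d → ℤ) → (Fin d → ℤ) → ℝ) (k : ℕ)
    (v : ℕ → Fin d → ℤ) : ℝ :=
  ∑ i ∈ Finset.range k, τ (v i) (v (i + 1) - v i)

/-- Total running cost `Σ p·(v_{i+1} − v_i)` of the first `k` steps of a path. -/
def pathCost {d : ℕ} (p : Fin d → ℝ) (k : ℕ) (v : ℕ → Fin d → ℤ) : ℝ :=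
  ∑ i ∈ Finset.range k, pdot p (v (i + 1) - v i)

/-- The discrete finite time-horizon value function `μ(x,t)`. -/
def valueFn {d : ℕ} (τ : (Fin d → ℤ) → (Fin d → ℤ) → ℝ) (p : Fin d → ℝ)
    (φ : (Fin d → ℤ) → ℝ) (x : Fin d → ℤ) (t : ℝ) : ℝ :=
  sInf {r : ℝ | ∃ (k : ℕ) (v : ℕ → Fin d → ℤ), IsPath x k v ∧
    pathWeight τ k v ≤ t ∧ r = pathCost p k v + φ (v k)}

theorem le_ham {d : ℕ} (τ : (Fin d → ℤ) → (Fin d → ℤ) → ℝ) (p : Fin d → ℝ)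
    (φ : (Fin d → ℤ) → ℝ) (x : Fin d → ℤ) {α : Fin d → ℤ} (hα : α ∈ dirs d) :
    (-(φ (x + α) - φ x) - pdot p α) / τ x α ≤ ham τ p φ x := by
  refine le_csSup ?_ ⟨α, hα, rfl⟩
  refine Set.Finite.bddAbove (((dirs d).finite_toSet.image
    fun α => (-(φ (x + α) - φ x) - pdot p α) / τ x α).subset ?_)
  rintro r ⟨β, hβ, rfl⟩
  exact ⟨β, hβ, rfl⟩

theorem pdot_neg {d : ℕ} (p : Fin d → ℝ) (α : Fin d → ℤ) : pdot p (-α) = -pdot p α := by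
  simp [pdot]

theorem exists_mem_dirs {d : ℕ} (hd : 1 ≤ d) : ∃ α ∈ dirs d, -α ∈ dirs d := by
  refine ⟨Pi.single ⟨0, hd⟩ 1, ?_, ?_⟩
  · exact Finset.mem_image.2 ⟨(⟨0, hd⟩, true), Finset.mem_univ _, by simp⟩
  · exact Finset.mem_image.2 ⟨(⟨0, hd⟩, false), Finset.mem_univ _, by simp⟩

/-- A uniform upper bound for the Hamiltonian of any function is nonnegative: crossing an edge
back and forth has zero total cost. -/
theorem nonneg_of_ham_le {d : ℕ} (hd : 1 ≤ d) {τ : (Fin d → ℤ) → (Fin d → ℤ) → ℝ}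
    (hτ : ∀ x, ∀ α ∈ dirs d, 0 < τ x α) {p : Fin d → ℝ} {φ : (Fin d → ℤ) → ℝ} {m : ℝ}
    (hm : ∀ x, ham τ p φ x ≤ m) : 0 ≤ m := by
  obtain ⟨α, hα, hα'⟩ := exists_mem_dirs hd
  have h1 := (div_le_iff₀ (hτ 0 α hα)).1 ((le_ham τ p φ 0 hα).trans (hm 0))
  have h2 := (div_le_iff₀ (hτ α (-α) hα')).1 ((le_ham τ p φ α hα').trans (hm α))
  rw [pdot_neg, add_neg_cancel] at h2
  rw [zero_add] at h1
  have := hτ 0 α hα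
  have := hτ α (-α) hα'
  by_contra! h
  nlinarith

theorem le_pathCost_add {d : ℕ} {τ : (Fin d → ℤ) → (Fin d → ℤ) → ℝ}
    (hτ : ∀ x, ∀ α ∈ dirs d, 0 < τ x α) {p : Fin d → ℝ} {φ : (Fin d → ℤ) → ℝ} {m : ℝ}
    (hm : ∀ x, ham τ p φ x ≤ m) {x : Fin d → ℤ} {k : ℕ} {v : ℕ → Fin d → ℤ}
    (hv : IsPath x k v) :
    φ x - m * pathWeight τ k v ≤ pathCost p k v + φ (v k) := by
  induction k with
  | zero => simp [pathWeight, pathCost, hv.1]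
  | succ k ih =>
    have ih := ih ⟨hv.1, fun i hi => hv.2 i (hi.trans k.lt_succ_self)⟩
    have hα := hv.2 k k.lt_succ_self
    have h := (div_le_iff₀ (hτ (v k) _ hα)).1 ((le_ham τ p φ (v k) hα).trans (hm (v k)))
    rw [add_sub_cancel] at h
    simp only [pathWeight, pathCost, Finset.sum_range_succ] at ih ⊢
    linarith

theorem le_valueFn {d : ℕ} (hd : 1 ≤ d) {τ : (Fin d → ℤ) → (Fin d → ℤ) → ℝ}
    (hτ : ∀ x, ∀ α ∈ dirs d, 0 < τ x α) {p : Fin d → ℝ} {φ : (Fin d → ℤ) → ℝ} {m : ℝ}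
    (hm : ∀ x, ham τ p φ x ≤ m) (x : Fin d → ℤ) {t : ℝ} (ht : 0 ≤ t) :
    φ x - m * t ≤ valueFn τ p φ x t := by
  refine le_csInf ⟨_, 0, fun _ => x, ⟨rfl, by simp⟩, by simpa [pathWeight] using ht, rfl⟩ ?_
  rintro r ⟨k, v, hv, hw, rfl⟩
  have := mul_le_mul_of_nonneg_left hw (nonneg_of_ham_le hd hτ hm)
  linarith [le_pathCost_add hτ hm hv]

theorem le_of_tendsto_valueFn {d : ℕ} (hd : 1 ≤ d) {τ : (Fin d → ℤ) → (Fin d → ℤ) → ℝ}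
    (hτ : ∀ x, ∀ α ∈ dirs d, 0 < τ x α) {p : Fin d → ℝ} {φ : (Fin d → ℤ) → ℝ} {m c : ℝ}
    (hm : ∀ x, ham τ p φ x ≤ m) (x : Fin d → ℤ)
    (hc : Tendsto (fun t : ℝ => valueFn τ p φ x t / t) atTop (nhds (-c))) : c ≤ m := by
  have hlim : Tendsto (fun t : ℝ => φ x / t - m) atTop (nhds (0 - m)) :=
    (tendsto_const_nhds.div_atTop tendsto_id).sub_const m
  have hle : 0 - m ≤ -c := by
    refine le_of_tendsto_of_tendsto hlim hc ?_
    filter_upwards [eventually_gt_atTop 0] with t ht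
    rw [le_div_iff₀ ht, sub_mul, div_mul_cancel₀ _ ht.ne']
    exact le_valueFn hd hτ hm x ht.le
  linarith

/-- upper-bound half of the discrete variational formula. If `φ ∈ S` is
a.s. Lipschitz and the scaled finite time-horizon value functions converge to `−c`
a.s., then `c ≤ esssup_ω sup_x 𝓗(φ,p,x,ω)`. -/
theorem stmt0 {d : ℕ} (hd : 1 ≤ d) {a b : ℝ} (ha : 0 < a) (hab : a ≤ b)
    {Ω : Type*} [MeasurableSpace Ω] (P : Measure Ω) [IsProbabilityMeasure P]
    (V : (Fin d → ℤ) → Ω → Ω)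
    (hVmp : ∀ z, MeasurePreserving (V z) P P)
    (hV0 : V 0 = id) (hVadd : ∀ z w, V (z + w) = V z ∘ V w)
    (τ : (Fin d → ℤ) → (Fin d → ℤ) → Ω → ℝ)
    (hτmeas : ∀ x α, Measurable (τ x α))
    (hτstat : ∀ x z α, ∀ᵐ ω ∂P, τ (x + z) α ω = τ x α (V z ω))
    (hτbd : ∀ᵐ ω ∂P, ∀ x, ∀ α ∈ dirs d, a ≤ τ x α ω ∧ τ x α ω ≤ b)
    (p : Fin d → ℝ)
    (φ : (Fin d → ℤ) → Ω → ℝ)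
    (hφmeas : ∀ x, Measurable (φ x))
    (hφstat : ∀ x z α, ∀ᵐ ω ∂P,
      φ (x + z + α) ω - φ (x + z) ω = φ (x + α) (V z ω) - φ x (V z ω))
    (hφint : ∀ x α, Integrable (fun ω => φ (x + α) ω - φ x ω) P)
    (hφmean : ∀ x α, ∫ ω, (φ (x + α) ω - φ x ω) ∂P = 0)
    (L : ℝ)
    (hφlip : ∀ᵐ ω ∂P, ∀ x y, |φ x ω - φ y ω| ≤ L * zl1 (x - y))
    (c : ℝ)
    (hconv : ∀ᵐ ω ∂P, Tendsto
      (fun t : ℝ => valueFn (fun y α => τ y α ω) p (fun y => φ y ω) 0 t / t)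
      atTop (nhds (-c))) :
    (c : EReal) ≤ essSup (fun ω => ⨆ x : Fin d → ℤ,
      ((ham (fun y α => τ y α ω) p (fun y => φ y ω) x : ℝ) : EReal)) P := by
  by_contra! h
  obtain ⟨m, hm, hmc⟩ := EReal.lt_iff_exists_real_btwn.1 h
  obtain ⟨ω, hω, hτω, hcω⟩ := ((ae_lt_of_essSup_lt hm).and (hτbd.and hconv)).exists
  have hle (x) : ham (fun y α => τ y α ω) p (fun y => φ y ω) x ≤ m :=
    EReal.coe_le_coe_iff.1 ((le_iSup (fun x => ((ham (fun y α => τ y α ω) p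
      (fun y => φ y ω) x : ℝ) : EReal)) x).trans hω.le)
  exact (EReal.coe_lt_coe_iff.1 hmc).not_ge <| le_of_tendsto_valueFn hd
    (fun x α hα => ha.trans_le (hτω x α hα).1) hle 0 hcω
end
end

section
/- Let (Ω, 𝓕, P) be a probability space, d ≥ 1 an integer, p ∈ ℝ^d, and for each α in A = {±e_1, …, ±e_d} ⊂ ℤ^d let ψ_α : Ω → ℝ be integrable with ∫_Ω ψ_α dP = 0. Then esssup_{ω∈Ω} max_{α∈A} ( −ψ_α(ω) − p·α ) ≥ |p|_∞, where p·α is the inner product and |p|_∞ the ℓ∞ norm of p. -/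
open MeasureTheory Filter

noncomputable section

/-- Every `i` admits a signed basis vector `α = ±e_i` with `-p·α = |p i|`. -/
theorem exists_mem_dirs_neg_pdot_eq_abs {d : ℕ} (p : Fin d → ℝ) (i : Fin d) :
    ∃ α ∈ dirs d, -pdot p α = |p i| := by
  have hp : pdot p (Pi.single i 1) = p i := by
    simp [pdot, Pi.single_apply]
  have hn : pdot p (-Pi.single i 1) = -p i := by
    simp [pdot, Pi.single_apply]
  rcases le_total 0 (p i) with h | h
  · refine ⟨-Pi.single i 1, Finset.mem_image.2 ⟨(i, false), Finset.mem_univ _, by simp⟩, ?_⟩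
    rw [hn, neg_neg, abs_of_nonneg h]
  · refine ⟨Pi.single i 1, Finset.mem_image.2 ⟨(i, true), Finset.mem_univ _, by simp⟩, ?_⟩
    rw [hp, abs_of_nonpos h]

/-- The supremum over the finite set of directions dominates each of its terms. -/
theorem le_sSup_dirs {d : ℕ} (g : (Fin d → ℤ) → ℝ) {α : Fin d → ℤ} (hα : α ∈ dirs d) :
    g α ≤ sSup {r : ℝ | ∃ β ∈ dirs d, r = g β} := by
  refine le_csSup (Set.Finite.bddAbove ?_) ⟨α, hα, rfl⟩
  refine ((dirs d).finite_toSet.image g).subset ?_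
  rintro r ⟨β, hβ, rfl⟩
  exact ⟨β, hβ, rfl⟩

/-- for any family `ψ_α`, `α ∈ A`, of integrable mean-zero random
variables, `esssup_ω max_{α∈A} (−ψ_α(ω) − p·α) ≥ |p|_∞`. -/
theorem stmt2 {d : ℕ} (hd : 1 ≤ d)
    {Ω : Type*} [MeasurableSpace Ω] (P : Measure Ω) [IsProbabilityMeasure P]
    (p : Fin d → ℝ) (ψ : (Fin d → ℤ) → Ω → ℝ)
    (hint : ∀ α ∈ dirs d, Integrable (ψ α) P)
    (hmean : ∀ α ∈ dirs d, ∫ ω, ψ α ω ∂P = 0) :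
    ((linf p : ℝ) : EReal) ≤
      essSup (fun ω =>
        ((sSup {r : ℝ | ∃ α ∈ dirs d, r = -ψ α ω - pdot p α} : ℝ) : EReal)) P := by
  have : Nonempty (Fin d) := ⟨⟨0, hd⟩⟩
  obtain ⟨i, hi⟩ := exists_eq_ciSup_of_finite (f := fun i => |p i|)
  obtain ⟨α, hα, hpα⟩ := exists_mem_dirs_neg_pdot_eq_abs p i
  have hlinf : linf p = -pdot p α := hi.symm.trans hpα.symm
  by_contra hlt
  obtain ⟨c, hMc, hcp⟩ := EReal.lt_iff_exists_real_btwn.1 (not_le.1 hlt)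
  have hae : ∀ᵐ ω ∂P, -ψ α ω - pdot p α ≤ c := by
    filter_upwards [ae_lt_of_essSup_lt hMc] with ω hω
    exact (le_sSup_dirs (fun β => -ψ β ω - pdot p β) hα).trans (EReal.coe_lt_coe_iff.1 hω).le
  have hle := integral_mono_ae ((hint α hα).neg.sub (integrable_const (pdot p α)))
    (integrable_const c) hae
  have heq : ∫ ω, (-ψ α ω - pdot p α) ∂P = -pdot p α := by
    rw [integral_sub (hint α hα).fun_neg (integrable_const _), integral_neg, hmean α hα]
    simp
  have hc : -pdot p α ≤ c := by
    rw [← heq]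
    simpa using hle
  exact absurd (EReal.coe_lt_coe_iff.1 hcp) (not_lt.2 (hlinf.le.trans hc))
end
end

section
/- Suppose ν : ℤ^d → ℝ satisfies the discounted dynamic programming principle ν(x) = min_{α∈A} ( p·α + exp(−ε·τ(x,α))·ν(x+α) ) for every x ∈ ℤ^d, together with the bounds −|p|_∞/(ε a) ≤ ν(x) ≤ 0 for all x. Then for every x ∈ ℤ^d and α ∈ A, ( −(ν(x+α) − ν(x)) − p·α ) / τ(x,α) ≤ |p|_∞ / a; in particular max_{α∈A} ( −(ν(x+α)−ν(x)) − p·α )/τ(x,α) ≤ |p|_∞/a. -/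
open MeasureTheory Filter

noncomputable section

/-- upper Lipschitz-type bound for the stationary cell-problem:
if `ν` satisfies the discounted DPP and `−|p|_∞/(εa) ≤ ν ≤ 0`, then for all `x`
and `α ∈ A`, `(−𝒟ν(x,α) − p·α)/τ(x,α) ≤ |p|_∞/a`; hence so does the max over `α`. -/
theorem stmt7 {d : ℕ} (hd : 1 ≤ d) {a b ε : ℝ} (ha : 0 < a) (hab : a ≤ b) (hε : 0 < ε)
    (τ : (Fin d → ℤ) → (Fin d → ℤ) → ℝ)
    (hτ : ∀ x, ∀ α ∈ dirs d, a ≤ τ x α ∧ τ x α ≤ b)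
    (p : Fin d → ℝ) (ν : (Fin d → ℤ) → ℝ)
    (hDPP : ∀ x, ν x = sInf {r : ℝ | ∃ α ∈ dirs d,
      r = pdot p α + Real.exp (-(ε * τ x α)) * ν (x + α)})
    (hν : ∀ x, -(linf p) / (ε * a) ≤ ν x ∧ ν x ≤ 0) :
    (∀ x : Fin d → ℤ, ∀ α ∈ dirs d,
      (-(ν (x + α) - ν x) - pdot p α) / τ x α ≤ linf p / a) ∧
    (∀ x : Fin d → ℤ,
      sSup {r : ℝ | ∃ α ∈ dirs d, r = (-(ν (x + α) - ν x) - pdot p α) / τ x α}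
        ≤ linf p / a) := by
  have bound : ∀ x : Fin d → ℤ, ∀ α ∈ dirs d,
      (-(ν (x + α) - ν x) - pdot p α) / τ x α ≤ linf p / a := by
    intro x α hα
    have hpos : 0 < τ x α := ha.trans_le (hτ x α hα).1
    have hfin : {r : ℝ | ∃ α ∈ dirs d,
        r = pdot p α + Real.exp (-(ε * τ x α)) * ν (x + α)}.Finite := by
      refine ((dirs d).finite_toSet.image
        fun α => pdot p α + Real.exp (-(ε * τ x α)) * ν (x + α)).subset ?_
      rintro r ⟨β, hβ, rfl⟩
      exact ⟨β, hβ, rfl⟩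
    have hstep : ν x ≤ pdot p α + Real.exp (-(ε * τ x α)) * ν (x + α) :=
      (hDPP x).trans_le (csInf_le hfin.bddBelow ⟨α, hα, rfl⟩)
    have hexp : 1 - Real.exp (-(ε * τ x α)) ≤ ε * τ x α := by
      linarith [Real.add_one_le_exp (-(ε * τ x α))]
    have hlow : -ν (x + α) ≤ linf p / (ε * a) := by
      have h := (hν (x + α)).1
      rw [neg_div] at h
      linarith
    rw [div_le_iff₀ hpos]
    calc -(ν (x + α) - ν x) - pdot p α
        ≤ (1 - Real.exp (-(ε * τ x α))) * -ν (x + α) := by linarith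
      _ ≤ ε * τ x α * -ν (x + α) :=
          mul_le_mul_of_nonneg_right hexp (neg_nonneg.2 (hν (x + α)).2)
      _ ≤ ε * τ x α * (linf p / (ε * a)) :=
          mul_le_mul_of_nonneg_left hlow (by positivity)
      _ = linf p / a * τ x α := by field_simp
  refine ⟨bound, fun x => Real.sSup_le ?_ ?_⟩
  · rintro r ⟨α, hα, rfl⟩
    exact bound x α hα
  · exact div_nonneg (Real.iSup_nonneg fun i => abs_nonneg (p i)) ha.le
end
end

section
/- Discrete Lipschitz estimate for the stationary cell-problem: suppose ν : ℤ^d → ℝ satisfies the discounted dynamic programming principle ν(x) = min_{α∈A} ( p·α + exp(−ε·τ(x,α))·ν(x+α) ) for every x ∈ ℤ^d, together with −|p|_∞/(ε a) ≤ ν(x) ≤ 0 for all x. Then |ν(x+α) − ν(x)| ≤ ((a+b)/a)·|p|_∞ for every x ∈ ℤ^d and α ∈ A; consequently |ν(x) − ν(y)| ≤ ((a+b)/a)·|p|_∞·|x−y|_1 for all x, y ∈ ℤ^d. -/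
open MeasureTheory Filter

noncomputable section

lemma single_mem_dirs {d : ℕ} (i : Fin d) : Pi.single i 1 ∈ dirs d :=
  Finset.mem_image.2 ⟨(i, true), Finset.mem_univ _, by simp⟩

lemma neg_mem_dirs {d : ℕ} {α : Fin d → ℤ} (h : α ∈ dirs d) : -α ∈ dirs d := by
  obtain ⟨⟨i, c⟩, -, rfl⟩ := Finset.mem_image.1 h
  refine Finset.mem_image.2 ⟨(i, !c), Finset.mem_univ _, ?_⟩
  cases c <;> simp

lemma linf_nonneg {d : ℕ} (p : Fin d → ℝ) : 0 ≤ linf p :=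
  Real.iSup_nonneg fun i => abs_nonneg (p i)

lemma abs_apply_le_linf {d : ℕ} (p : Fin d → ℝ) (i : Fin d) : |p i| ≤ linf p :=
  le_ciSup (f := fun i => |p i|) (Set.finite_range _).bddAbove i

lemma pdot_single {d : ℕ} (p : Fin d → ℝ) (i : Fin d) (m : ℤ) :
    pdot p (Pi.single i m) = p i * m := by
  unfold pdot
  rw [Finset.sum_eq_single i]
  · simp
  · intro j _ hj
    simp [Pi.single_eq_of_ne hj]
  · simp

lemma pdot_le_linf {d : ℕ} (p : Fin d → ℝ) {α : Fin d → ℤ} (h : α ∈ dirs d) :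
    pdot p α ≤ linf p := by
  obtain ⟨⟨i, c⟩, -, rfl⟩ := Finset.mem_image.1 h
  have hi := abs_le.1 (abs_apply_le_linf p i)
  cases c
  · simp only [Bool.false_eq_true, if_false, ← Pi.single_neg, pdot_single]
    push_cast
    linarith
  · simp only [if_true, pdot_single]
    push_cast
    linarith

/-- A bound on nearest-neighbor increments gives an `ℓ¹` Lipschitz bound on `ℤ^d`. -/
lemma abs_sub_le_mul_zl1 {d : ℕ} {C : ℝ} {ν : (Fin d → ℤ) → ℝ}
    (h : ∀ x, ∀ i, |ν (x + Pi.single i 1) - ν x| ≤ C) (x y : Fin d → ℤ) :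
    |ν x - ν y| ≤ C * zl1 (x - y) := by
  have hnat : ∀ (i : Fin d) (n : ℕ) (x : Fin d → ℤ),
      |ν (x + Pi.single i (n : ℤ)) - ν x| ≤ C * n := by
    intro i n
    induction n with
    | zero => simp
    | succ n ih =>
      intro x
      have h1 := h (x + Pi.single i (n : ℤ)) i
      rw [add_assoc, ← Pi.single_add] at h1
      have h2 := abs_sub_le (ν (x + Pi.single i ((n : ℤ) + 1))) (ν (x + Pi.single i (n : ℤ))) (ν x)
      have h3 := ih x
      push_cast
      linarith
  have hint : ∀ (i : Fin d) (m : ℤ) (x : Fin d → ℤ),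
      |ν (x + Pi.single i m) - ν x| ≤ C * |(m : ℝ)| := by
    intro i m x
    obtain ⟨n, rfl | rfl⟩ := m.eq_nat_or_neg
    · simpa using hnat i n x
    · have := hnat i n (x + Pi.single i (-(n : ℤ)))
      rw [add_assoc, ← Pi.single_add, neg_add_cancel, Pi.single_zero, add_zero, abs_sub_comm] at this
      simpa using this
  have hsum : ∀ (z : Fin d → ℤ) (s : Finset (Fin d)) (x : Fin d → ℤ),
      |ν (x + ∑ i ∈ s, Pi.single i (z i)) - ν x| ≤ C * ∑ i ∈ s, |(z i : ℝ)| := by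
    intro z s
    induction s using Finset.induction_on with
    | empty => simp
    | insert i s hi ih =>
      intro x
      rw [Finset.sum_insert hi, Finset.sum_insert hi, ← add_assoc, mul_add]
      have h1 := ih (x + Pi.single i (z i))
      have h2 := hint i (z i) x
      have h3 := abs_sub_le (ν (x + Pi.single i (z i) + ∑ i ∈ s, Pi.single i (z i)))
        (ν (x + Pi.single i (z i))) (ν x)
      linarith
  have := hsum (x - y) Finset.univ y
  rw [Finset.univ_sum_single, add_sub_cancel] at this
  exact this

/-- discrete Lipschitz estimate for the stationary cell-problem:
`|𝒟ν(x,α)| ≤ ((a+b)/a)|p|_∞` for every `x` and `α ∈ A`, and consequently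
`|ν(x) − ν(y)| ≤ ((a+b)/a)|p|_∞ |x−y|_1`. -/
theorem stmt9 {d : ℕ} (hd : 1 ≤ d) {a b ε : ℝ} (ha : 0 < a) (hab : a ≤ b) (hε : 0 < ε)
    (τ : (Fin d → ℤ) → (Fin d → ℤ) → ℝ)
    (hτ : ∀ x, ∀ α ∈ dirs d, a ≤ τ x α ∧ τ x α ≤ b)
    (p : Fin d → ℝ) (ν : (Fin d → ℤ) → ℝ)
    (hDPP : ∀ x, ν x = sInf {r : ℝ | ∃ α ∈ dirs d,
      r = pdot p α + Real.exp (-(ε * τ x α)) * ν (x + α)})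
    (hν : ∀ x, -(linf p) / (ε * a) ≤ ν x ∧ ν x ≤ 0) :
    (∀ x : Fin d → ℤ, ∀ α ∈ dirs d,
      |ν (x + α) - ν x| ≤ ((a + b) / a) * linf p) ∧
    (∀ x y : Fin d → ℤ,
      |ν x - ν y| ≤ ((a + b) / a) * linf p * zl1 (x - y)) := by
  have hL := linf_nonneg p
  have key : ∀ x, ∀ α ∈ dirs d, ν x - ν (x + α) ≤ ((a + b) / a) * linf p := by
    intro x α hα
    have hfin : {r : ℝ | ∃ α ∈ dirs d,
        r = pdot p α + Real.exp (-(ε * τ x α)) * ν (x + α)}.Finite := by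
      refine ((dirs d).finite_toSet.image
        fun α => pdot p α + Real.exp (-(ε * τ x α)) * ν (x + α)).subset ?_
      rintro r ⟨β, hβ, rfl⟩
      exact ⟨β, hβ, rfl⟩
    have hle : ν x ≤ pdot p α + Real.exp (-(ε * τ x α)) * ν (x + α) := by
      rw [hDPP x]
      exact csInf_le hfin.bddBelow ⟨α, hα, rfl⟩
    obtain ⟨hνl, hνu⟩ := hν (x + α)
    obtain ⟨-, hτb⟩ := hτ x α hα
    have hexp : 1 - Real.exp (-(ε * τ x α)) ≤ ε * b := by
      have := Real.add_one_le_exp (-(ε * τ x α))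
      have := mul_le_mul_of_nonneg_left hτb hε.le
      linarith
    have hb : 0 < b := ha.trans_le hab
    have hdisc : (1 - Real.exp (-(ε * τ x α))) * (-ν (x + α)) ≤
        ε * b * (linf p / (ε * a)) := by
      rw [neg_div] at hνl
      exact mul_le_mul hexp (by linarith) (by linarith) (by positivity)
    have hconst : linf p + ε * b * (linf p / (ε * a)) = ((a + b) / a) * linf p := by
      field_simp
    have := pdot_le_linf p hα
    linarith
  have hstep : ∀ x : Fin d → ℤ, ∀ α ∈ dirs d,
      |ν (x + α) - ν x| ≤ ((a + b) / a) * linf p := by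
    intro x α hα
    have h1 := key x α hα
    have h2 := key (x + α) (-α) (neg_mem_dirs hα)
    rw [add_neg_cancel_right] at h2
    exact abs_le.2 ⟨by linarith, h2⟩
  exact ⟨hstep, abs_sub_le_mul_zl1 fun x i => hstep x _ (single_mem_dirs i)⟩
end
end

section
/- Suppose V : Ω → Ω is an invertible, measure-preserving, ergodic transformation of the probability space (Ω, 𝓕, P), and let the ℤ^d-action be V_z = V^{z_1+⋯+z_d} for z = (z_1,…,z_d) ∈ ℤ^d. Let φ : ℤ^d × Ω → ℝ be jointly measurable with stationary, integrable, mean-zero discrete derivatives with respect to this action: φ(x+z+α,ω) − φ(x+z,ω) = φ(x+α,V_zω) − φ(x,V_zω) for all x, z ∈ ℤ^d, α ∈ A and a.e. ω, and E[φ(x+α,·) − φ(x,·)] = 0 for all x, α. Then for P-almost every ω, φ(x+e_i,ω) − φ(x,ω) = φ(x+e_j,ω) − φ(x,ω) for every x ∈ ℤ^d and all 1 ≤ i, j ≤ d; that is, the discrete derivative of φ is the same in every positive coordinate direction. -/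
open MeasureTheory Filter

noncomputable section

/-- under the symmetry assumption `V_{e_1} = ⋯ = V_{e_d} = V` (the
`ℤ^d`-action is `z ↦ V^{z_1+⋯+z_d}`, encoded by the `ℤ`-action `W`), any `φ` with
stationary, integrable, mean-zero discrete derivatives has, almost surely, the same
discrete derivative in every positive coordinate direction. -/
theorem stmt12 {d : ℕ} {Ω : Type*} [MeasurableSpace Ω] (P : Measure Ω)
    [IsProbabilityMeasure P]
    (V : Ω → Ω) (W : ℤ → Ω → Ω)
    (hW1 : W 1 = V) (hW0 : W 0 = id) (hWadd : ∀ m n, W (m + n) = W m ∘ W n)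
    (hWmp : ∀ n, MeasurePreserving (W n) P P)
    (hVerg : Ergodic V P)
    (φ : (Fin d → ℤ) → Ω → ℝ)
    (hφmeas : ∀ x, Measurable (φ x))
    (hφstat : ∀ x z α : Fin d → ℤ, ∀ᵐ ω ∂P,
      φ (x + z + α) ω - φ (x + z) ω
        = φ (x + α) (W (∑ i, z i) ω) - φ x (W (∑ i, z i) ω))
    (hφint : ∀ x α, Integrable (fun ω => φ (x + α) ω - φ x ω) P)
    (hφmean : ∀ x, ∀ α ∈ dirs d, ∫ ω, (φ (x + α) ω - φ x ω) ∂P = 0) :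
    ∀ᵐ ω ∂P, ∀ (x : Fin d → ℤ) (i j : Fin d),
      φ (x + Pi.single i 1) ω - φ x ω = φ (x + Pi.single j 1) ω - φ x ω := by
  have h_zero : ∀ i j : Fin d, ∀ᵐ ω ∂P,
      φ (0 + Pi.single i 1) ω - φ 0 ω = φ (0 + Pi.single j 1) ω - φ 0 ω := by
    intro i j
    let g : Ω → ℝ := fun ω =>
      (φ (0 + Pi.single i 1) ω - φ 0 ω) - (φ (0 + Pi.single j 1) ω - φ 0 ω)
    have hg_meas : Measurable g := by
      have h0 := hφmeas 0
      have hi := hφmeas (0 + Pi.single i 1)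
      have hj := hφmeas (0 + Pi.single j 1)
      fun_prop
    have hg_inv : g ∘ V =ᵐ[P] g := by
      filter_upwards [hφstat 0 (Pi.single j 1) (Pi.single i 1),
        hφstat 0 (Pi.single i 1) (Pi.single j 1)] with ω h1 h2
      simp only [Finset.sum_pi_single', Finset.mem_univ, if_true, hW1] at h1 h2
      rw [add_right_comm] at h2
      simp only [g, Function.comp_apply]
      linarith
    obtain ⟨c, hc⟩ := hVerg.ae_eq_const_of_ae_eq_comp_ae hg_meas.aestronglyMeasurable hg_inv
    have h_dirs : ∀ k : Fin d, (Pi.single k 1 : Fin d → ℤ) ∈ dirs d := fun k =>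
      Finset.mem_image.2 ⟨(k, true), Finset.mem_univ _, rfl⟩
    have hg_mean : ∫ ω, g ω ∂P = 0 := by
      rw [integral_sub (hφint 0 _) (hφint 0 _), hφmean 0 _ (h_dirs i), hφmean 0 _ (h_dirs j),
        sub_zero]
    have hc0 : c = 0 := by
      rw [integral_congr_ae hc] at hg_mean
      simpa using hg_mean
    filter_upwards [hc] with ω hω
    exact sub_eq_zero.1 (hω.trans hc0)
  refine ae_all_iff.2 fun x => ae_all_iff.2 fun i => ae_all_iff.2 fun j => ?_
  filter_upwards [hφstat 0 x (Pi.single i 1), hφstat 0 x (Pi.single j 1),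
    (hWmp (∑ k, x k)).quasiMeasurePreserving.ae (h_zero i j)] with ω hi hj h
  rw [zero_add] at hi hj
  rw [hi, hj, h]
end
end

section
/- Let I be a nonempty finite set, 0 < a ≤ b, and for each i ∈ I let c_i ∈ ℝ and τ_i ∈ [a,b]. Define H(t) = max_{i∈I} |t + c_i|/τ_i for t ∈ ℝ. Then: (i) H is convex on ℝ; (ii) H has a unique minimizer t* ∈ ℝ; (iii) for all s, t with t* ≤ s < t one has (t−s)/b ≤ H(t) − H(s) ≤ (t−s)/a, and for all s, t with s < t ≤ t* one has (t−s)/b ≤ H(s) − H(t) ≤ (t−s)/a. (Equivalently, at every point the one-sided slopes of H lie in [1/b, 1/a] to the right of its minimum and in [−1/a, −1/b] to the left.) -/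
noncomputable section

/-- The symmetrized Hamiltonian `H(t) = max_{i∈I} |t + c_i|/τ_i`. -/
def Hsym {ι : Type*} (I : Finset ι) (hI : I.Nonempty) (c τ : ι → ℝ) (t : ℝ) : ℝ :=
  I.sup' hI (fun i => |t + c i| / τ i)

/-- The increasing branch `max_{i∈I} (t + c_i)/τ_i` of the symmetrized Hamiltonian. -/
def Hpos {ι : Type*} (I : Finset ι) (hI : I.Nonempty) (c τ : ι → ℝ) (t : ℝ) : ℝ :=
  I.sup' hI (fun i => (t + c i) / τ i)

theorem continuous_Hpos {ι : Type*} (I : Finset ι) (hI : I.Nonempty) (c τ : ι → ℝ) :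
    Continuous (Hpos I hI c τ) :=
  Continuous.finset_sup'_apply hI fun i _ => by fun_prop

theorem Hpos_add_le {ι : Type*} (I : Finset ι) (hI : I.Nonempty) {a b : ℝ}
    (ha : 0 < a) (c τ : ι → ℝ) (hτ : ∀ i ∈ I, τ i ∈ Set.Icc a b) {s t : ℝ} (hst : s ≤ t) :
    Hpos I hI c τ s + (t - s) / b ≤ Hpos I hI c τ t := by
  obtain ⟨i, hi, his⟩ := I.exists_mem_eq_sup' hI (fun i => (s + c i) / τ i)
  have hle : (t + c i) / τ i ≤ Hpos I hI c τ t :=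
    I.le_sup' (fun i => (t + c i) / τ i) hi
  have hdiv : (t - s) / b ≤ (t - s) / τ i :=
    div_le_div_of_nonneg_left (by linarith) (ha.trans_le (hτ i hi).1) (hτ i hi).2
  have hs : Hpos I hI c τ s = (s + c i) / τ i := his
  have hsplit : (t + c i) / τ i = (s + c i) / τ i + (t - s) / τ i := by ring
  linarith

theorem Hpos_le_add {ι : Type*} (I : Finset ι) (hI : I.Nonempty) {a b : ℝ}
    (ha : 0 < a) (c τ : ι → ℝ) (hτ : ∀ i ∈ I, τ i ∈ Set.Icc a b) {s t : ℝ} (hst : s ≤ t) :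
    Hpos I hI c τ t ≤ Hpos I hI c τ s + (t - s) / a := by
  refine I.sup'_le hI _ fun i hi => ?_
  have hle : (s + c i) / τ i ≤ Hpos I hI c τ s :=
    I.le_sup' (fun i => (s + c i) / τ i) hi
  have hdiv : (t - s) / τ i ≤ (t - s) / a :=
    div_le_div_of_nonneg_left (by linarith) ha (hτ i hi).1
  have hsplit : (t + c i) / τ i = (s + c i) / τ i + (t - s) / τ i := by ring
  linarith

theorem Hsym_eq_max {ι : Type*} (I : Finset ι) (hI : I.Nonempty) (c τ : ι → ℝ)
    (hτ : ∀ i ∈ I, 0 < τ i) (t : ℝ) :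
    Hsym I hI c τ t = max (Hpos I hI c τ t) (Hpos I hI (-c) τ (-t)) := by
  have hterm (i : ι) (hi : i ∈ I) :
      |t + c i| / τ i = max ((t + c i) / τ i) ((-t + (-c) i) / τ i) := by
    have hneg : -t + (-c) i = -(t + c i) := by simp only [Pi.neg_apply]; ring
    rw [hneg, max_div_div_right (hτ i hi).le]
    rfl
  refine eq_of_forall_ge_iff fun r => ?_
  simp only [Hsym, Hpos, max_le_iff, Finset.sup'_le_iff, ← forall_and]
  refine forall₂_congr fun i hi => ?_
  rw [hterm i hi, max_le_iff]

theorem convexOn_Hsym {ι : Type*} (I : Finset ι) (hI : I.Nonempty) (c τ : ι → ℝ)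
    (hτ : ∀ i ∈ I, 0 < τ i) : ConvexOn ℝ Set.univ (Hsym I hI c τ) := by
  refine ⟨convex_univ, fun x _ y _ p q hp hq hpq => I.sup'_le hI _ fun i hi => ?_⟩
  have hx : |x + c i| / τ i ≤ Hsym I hI c τ x := I.le_sup' (fun i => |x + c i| / τ i) hi
  have hy : |y + c i| / τ i ≤ Hsym I hI c τ y := I.le_sup' (fun i => |y + c i| / τ i) hi
  simp only [smul_eq_mul]
  calc |p * x + q * y + c i| / τ i = |p * (x + c i) + q * (y + c i)| / τ i := by
        congr 2; linear_combination (-c i) * hpq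
    _ ≤ (p * |x + c i| + q * |y + c i|) / τ i := by
        have habs := abs_add_le (p * (x + c i)) (q * (y + c i))
        rw [abs_mul, abs_mul, abs_of_nonneg hp, abs_of_nonneg hq] at habs
        exact div_le_div_of_nonneg_right habs (hτ i hi).le
    _ = p * (|x + c i| / τ i) + q * (|y + c i| / τ i) := by ring
    _ ≤ p * Hsym I hI c τ x + q * Hsym I hI c τ y := by gcongr

/-- The increasing and decreasing branches of the symmetrized Hamiltonian cross. -/
theorem exists_Hpos_eq {ι : Type*} (I : Finset ι) (hI : I.Nonempty) {a b : ℝ}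
    (ha : 0 < a) (hab : a ≤ b) (c τ : ι → ℝ) (hτ : ∀ i ∈ I, τ i ∈ Set.Icc a b) :
    ∃ t : ℝ, Hpos I hI c τ t = Hpos I hI (-c) τ (-t) := by
  have hb : b ≠ 0 := (ha.trans_le hab).ne'
  set d := |Hpos I hI c τ 0 - Hpos I hI (-c) τ 0| with hd
  have hdb : 0 ≤ d * b := mul_nonneg (abs_nonneg _) (ha.trans_le hab).le
  have hdiff := abs_le.1 hd.ge
  have hbranch (e : ι → ℝ) : Hpos I hI e τ (-(d * b)) + d ≤ Hpos I hI e τ 0 ∧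
      Hpos I hI e τ 0 + d ≤ Hpos I hI e τ (d * b) := by
    have hleft := Hpos_add_le I hI ha e τ hτ (neg_nonpos.2 hdb)
    have hright := Hpos_add_le I hI ha e τ hτ hdb
    rw [zero_sub, neg_neg, mul_div_cancel_right₀ _ hb] at hleft
    rw [sub_zero, mul_div_cancel_right₀ _ hb] at hright
    exact ⟨hleft, hright⟩
  have hpos := hbranch c
  have hneg := hbranch (-c)
  have hd0 : 0 ≤ d := abs_nonneg _
  have hcont : Continuous fun t => Hpos I hI c τ t - Hpos I hI (-c) τ (-t) :=
    (continuous_Hpos I hI c τ).sub ((continuous_Hpos I hI (-c) τ).comp continuous_neg)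
  obtain ⟨t, ht⟩ := mem_range_of_exists_le_of_exists_ge hcont
    (c := 0) ⟨-(d * b), by rw [neg_neg]; linarith⟩ ⟨d * b, by linarith⟩
  exact ⟨t, sub_eq_zero.1 ht⟩

/-- `H(t) = max_{i∈I} |t + c_i|/τ_i` with `τ_i ∈ [a,b]` is convex, has a
unique minimizer `t*`, and its slopes lie in `[1/b, 1/a]` to the right of `t*` and in
`[−1/a, −1/b]` to the left of `t*`. -/
theorem stmt14 {ι : Type*} (I : Finset ι) (hI : I.Nonempty) {a b : ℝ}
    (ha : 0 < a) (hab : a ≤ b) (c τ : ι → ℝ) (hτ : ∀ i ∈ I, τ i ∈ Set.Icc a b) :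
    ConvexOn ℝ Set.univ (Hsym I hI c τ) ∧
    ∃ tstar : ℝ,
      (∀ t, Hsym I hI c τ tstar ≤ Hsym I hI c τ t) ∧
      (∀ t', (∀ t, Hsym I hI c τ t' ≤ Hsym I hI c τ t) → t' = tstar) ∧
      (∀ s t : ℝ, tstar ≤ s → s < t →
        (t - s) / b ≤ Hsym I hI c τ t - Hsym I hI c τ s ∧
        Hsym I hI c τ t - Hsym I hI c τ s ≤ (t - s) / a) ∧
      (∀ s t : ℝ, s < t → t ≤ tstar →
        (t - s) / b ≤ Hsym I hI c τ s - Hsym I hI c τ t ∧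
        Hsym I hI c τ s - Hsym I hI c τ t ≤ (t - s) / a) := by
  have hb : 0 < b := ha.trans_le hab
  have hτ0 : ∀ i ∈ I, 0 < τ i := fun i hi => ha.trans_le (hτ i hi).1
  obtain ⟨m, hm⟩ := exists_Hpos_eq I hI ha hab c τ hτ
  have hmono (e : ι → ℝ) {s t : ℝ} (hst : s ≤ t) : Hpos I hI e τ s ≤ Hpos I hI e τ t :=
    (le_add_of_nonneg_right (div_nonneg (sub_nonneg.2 hst) hb.le)).trans
      (Hpos_add_le I hI ha e τ hτ hst)
  have heq_right {t : ℝ} (ht : m ≤ t) : Hsym I hI c τ t = Hpos I hI c τ t := by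
    rw [Hsym_eq_max I hI c τ hτ0, max_eq_left]
    exact (hmono (-c) (neg_le_neg ht)).trans (hm.ge.trans (hmono c ht))
  have heq_left {t : ℝ} (ht : t ≤ m) : Hsym I hI c τ t = Hpos I hI (-c) τ (-t) := by
    rw [Hsym_eq_max I hI c τ hτ0, max_eq_right]
    exact (hmono c ht).trans (hm.le.trans (hmono (-c) (neg_le_neg ht)))
  have hright (s t : ℝ) (hs : m ≤ s) (hst : s < t) :
      (t - s) / b ≤ Hsym I hI c τ t - Hsym I hI c τ s ∧
        Hsym I hI c τ t - Hsym I hI c τ s ≤ (t - s) / a := by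
    rw [heq_right hs, heq_right (hs.trans hst.le)]
    exact ⟨le_sub_iff_add_le'.2 (Hpos_add_le I hI ha c τ hτ hst.le),
      sub_le_iff_le_add'.2 (Hpos_le_add I hI ha c τ hτ hst.le)⟩
  have hleft (s t : ℝ) (hst : s < t) (ht : t ≤ m) :
      (t - s) / b ≤ Hsym I hI c τ s - Hsym I hI c τ t ∧
        Hsym I hI c τ s - Hsym I hI c τ t ≤ (t - s) / a := by
    rw [heq_left ht, heq_left (hst.le.trans ht), ← neg_sub_neg s t]
    exact ⟨le_sub_iff_add_le'.2 (Hpos_add_le I hI ha (-c) τ hτ (neg_le_neg hst.le)),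
      sub_le_iff_le_add'.2 (Hpos_le_add I hI ha (-c) τ hτ (neg_le_neg hst.le))⟩
  have hlt (t : ℝ) (ht : t ≠ m) : Hsym I hI c τ m < Hsym I hI c τ t := by
    rcases ht.lt_or_gt with h | h
    · exact sub_pos.1 ((div_pos (sub_pos.2 h) hb).trans_le (hleft t m h le_rfl).1)
    · exact sub_pos.1 ((div_pos (sub_pos.2 h) hb).trans_le (hright m t le_rfl h).1)
  refine ⟨convexOn_Hsym I hI c τ hτ0, m, fun t => ?_, fun t ht => ?_, hright, hleft⟩
  · rcases eq_or_ne t m with rfl | h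
    · exact le_rfl
    · exact (hlt t h).le
  · by_contra h
    exact (hlt t h).not_ge (ht m)
end
end

section
/- Comparison of two first-passage percolation metrics: let τ_1, τ_2 : ℤ^d × A → ℝ be two edge-weight functions with a_i ≤ τ_i(y,α) ≤ b_i for all y, α (where 0 < a_i ≤ b_i, i = 1,2), and let 𝒯_i(x,y) be the corresponding first-passage times. If D ≥ 0 satisfies |τ_1(y,α) − τ_2(y,α)| ≤ D for all y ∈ ℤ^d and α ∈ A, then for every x ∈ ℤ^d, |𝒯_1(0,x) − 𝒯_2(0,x)| ≤ max(b_1/a_1, b_2/a_2) · D · |x|_1. -/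
open MeasureTheory Filter

noncomputable section

/-- The first-passage time `𝒯(x,y)`: infimum of path weight over nearest-neighbor
paths from `x` to `y`. -/
def fpt {d : ℕ} (τ : (Fin d → ℤ) → (Fin d → ℤ) → ℝ) (x y : Fin d → ℤ) : ℝ :=
  sInf {r : ℝ | ∃ (k : ℕ) (v : ℕ → Fin d → ℤ), IsPath x k v ∧ v k = y ∧
    r = pathWeight τ k v}

/-- A nearest-neighbor path can be prolonged by one step. -/
theorem exists_isPath_succ {d : ℕ} {x y z : Fin d → ℤ} {k : ℕ} {v : ℕ → Fin d → ℤ}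
    (hv : IsPath x k v) (hk : v k = y) (hz : z - y ∈ dirs d) :
    ∃ w, IsPath x (k + 1) w ∧ w (k + 1) = z := by
  refine ⟨fun i => if i ≤ k then v i else z, ⟨by simpa using hv.1, fun i hi => ?_⟩, by simp⟩
  rcases Nat.lt_succ_iff_lt_or_eq.mp hi with h | rfl
  · simpa [h.le, Nat.succ_le_iff.mpr h] using hv.2 i h
  · simpa [hk] using hz

/-- Every lattice point is the end of a path from the origin of length its `ℓ¹` norm. -/
theorem exists_isPath_length_eq_zl1 {d : ℕ} (x : Fin d → ℤ) :
    ∃ (k : ℕ) (v : ℕ → Fin d → ℤ), IsPath 0 k v ∧ v k = x ∧ (k : ℝ) = zl1 x := by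
  suffices h : ∀ (n : ℕ) (x : Fin d → ℤ), ∑ i, (x i).natAbs = n →
      ∃ v : ℕ → Fin d → ℤ, IsPath 0 n v ∧ v n = x by
    obtain ⟨v, hv, hvx⟩ := h _ x rfl
    exact ⟨_, v, hv, hvx, by simp [zl1, Nat.cast_natAbs]⟩
  intro n
  induction n with
  | zero =>
    intro x hx
    have hx0 : x = 0 := by
      ext i
      simpa using (Finset.sum_eq_zero_iff.mp hx) i (Finset.mem_univ i)
    exact ⟨fun _ => 0, ⟨rfl, fun i hi => absurd hi (Nat.not_lt_zero i)⟩, hx0.symm⟩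
  | succ n ih =>
    intro x hx
    obtain ⟨i, hi⟩ : ∃ i, x i ≠ 0 := by
      by_contra! h
      simp [h] at hx
    obtain ⟨s, hs, hs'⟩ : ∃ s : ℤ, (s = 1 ∨ s = -1) ∧
        (x i).natAbs = (x i - s).natAbs + 1 := by
      rcases lt_or_gt_of_ne hi with h | h
      · exact ⟨-1, Or.inr rfl, by omega⟩
      · exact ⟨1, Or.inl rfl, by omega⟩
    have hsum : ∑ j, ((x - Pi.single i s : Fin d → ℤ) j).natAbs = n := by
      rw [← Finset.add_sum_erase _ _ (Finset.mem_univ i)] at hx ⊢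
      have hrest : ∑ j ∈ Finset.univ.erase i, ((x - Pi.single i s : Fin d → ℤ) j).natAbs =
          ∑ j ∈ Finset.univ.erase i, (x j).natAbs :=
        Finset.sum_congr rfl fun j hj => by simp [Finset.ne_of_mem_erase hj]
      rw [hrest]
      simp only [Pi.sub_apply, Pi.single_eq_same]
      omega
    obtain ⟨v, hv, hvx⟩ := ih _ hsum
    refine exists_isPath_succ hv hvx ?_
    rw [sub_sub_cancel]
    rcases hs with rfl | rfl
    · exact Finset.mem_image.mpr ⟨(i, true), Finset.mem_univ _, by simp⟩
    · exact Finset.mem_image.mpr ⟨(i, false), Finset.mem_univ _, by simp [Pi.single_neg]⟩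

theorem mul_length_le_pathWeight {d : ℕ} {τ : (Fin d → ℤ) → (Fin d → ℤ) → ℝ} {a : ℝ}
    (hτ : ∀ y, ∀ α ∈ dirs d, a ≤ τ y α) {x : Fin d → ℤ} {k : ℕ} {v : ℕ → Fin d → ℤ}
    (hv : IsPath x k v) : a * k ≤ pathWeight τ k v := by
  have h := Finset.card_nsmul_le_sum (Finset.range k) _ a
    fun i hi => hτ (v i) _ (hv.2 i (Finset.mem_range.mp hi))
  simpa [pathWeight, mul_comm] using h

theorem pathWeight_le_mul_length {d : ℕ} {τ : (Fin d → ℤ) → (Fin d → ℤ) → ℝ} {b : ℝ}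
    (hτ : ∀ y, ∀ α ∈ dirs d, τ y α ≤ b) {x : Fin d → ℤ} {k : ℕ} {v : ℕ → Fin d → ℤ}
    (hv : IsPath x k v) : pathWeight τ k v ≤ b * k := by
  have h := Finset.sum_le_card_nsmul (Finset.range k) _ b
    fun i hi => hτ (v i) _ (hv.2 i (Finset.mem_range.mp hi))
  simpa [pathWeight, mul_comm] using h

theorem fpt_le_pathWeight {d : ℕ} {τ : (Fin d → ℤ) → (Fin d → ℤ) → ℝ}
    (hτ : ∀ y, ∀ α ∈ dirs d, 0 ≤ τ y α) {x y : Fin d → ℤ} {k : ℕ} {v : ℕ → Fin d → ℤ}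
    (hv : IsPath x k v) (hy : v k = y) : fpt τ x y ≤ pathWeight τ k v := by
  refine csInf_le ⟨0, ?_⟩ ⟨k, v, hv, hy, rfl⟩
  rintro _ ⟨l, w, hw, -, rfl⟩
  simpa using mul_length_le_pathWeight hτ hw

theorem fpt_zero_le_mul_zl1 {d : ℕ} {τ : (Fin d → ℤ) → (Fin d → ℤ) → ℝ} {b : ℝ}
    (hτ : ∀ y, ∀ α ∈ dirs d, 0 ≤ τ y α ∧ τ y α ≤ b) (x : Fin d → ℤ) :
    fpt τ 0 x ≤ b * zl1 x := by
  obtain ⟨k, v, hv, hvx, hk⟩ := exists_isPath_length_eq_zl1 x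
  rw [← hk]
  exact (fpt_le_pathWeight (fun y α hα => (hτ y α hα).1) hv hvx).trans
    (pathWeight_le_mul_length (fun y α hα => (hτ y α hα).2) hv)

/-- One-sided comparison of first-passage times. -/
theorem fpt_sub_fpt_le {d : ℕ} {τ σ : (Fin d → ℤ) → (Fin d → ℤ) → ℝ} {a b D : ℝ}
    (ha : 0 < a) (hτ : ∀ y, ∀ α ∈ dirs d, 0 ≤ τ y α)
    (hσ : ∀ y, ∀ α ∈ dirs d, a ≤ σ y α ∧ σ y α ≤ b) (hD : 0 ≤ D)
    (hdist : ∀ y, ∀ α ∈ dirs d, τ y α - σ y α ≤ D) (x : Fin d → ℤ) :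
    fpt τ 0 x - fpt σ 0 x ≤ b / a * D * zl1 x := by
  have hpos : 0 < 1 + D / a := by positivity
  have hle : fpt τ 0 x / (1 + D / a) ≤ fpt σ 0 x := by
    obtain ⟨l, w, hw, hwx, -⟩ := exists_isPath_length_eq_zl1 x
    refine le_csInf ⟨_, l, w, hw, hwx, rfl⟩ ?_
    rintro _ ⟨k, v, hv, hvx, rfl⟩
    rw [div_le_iff₀ hpos]
    have hdiff : pathWeight τ k v - pathWeight σ k v ≤ D * k := by
      have h := pathWeight_le_mul_length (τ := fun y α => τ y α - σ y α) hdist hv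
      simpa only [pathWeight, Finset.sum_sub_distrib] using h
    have hk : (k : ℝ) ≤ pathWeight σ k v / a := by
      rw [le_div_iff₀ ha, mul_comm]
      exact mul_length_le_pathWeight (fun y α hα => (hσ y α hα).1) hv
    calc fpt τ 0 x ≤ pathWeight τ k v := fpt_le_pathWeight hτ hv hvx
      _ ≤ pathWeight σ k v + D * k := by linarith
      _ ≤ pathWeight σ k v + D * (pathWeight σ k v / a) := by gcongr
      _ = pathWeight σ k v * (1 + D / a) := by ring
  rw [div_le_iff₀ hpos] at hle
  calc fpt τ 0 x - fpt σ 0 x ≤ D / a * fpt σ 0 x := by linarith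
    _ ≤ D / a * (b * zl1 x) := by
      gcongr
      exact fpt_zero_le_mul_zl1 (fun y α hα => ⟨ha.le.trans (hσ y α hα).1, (hσ y α hα).2⟩) x
    _ = b / a * D * zl1 x := by ring

/-- comparison of two first-passage percolation metrics. If the two
edge-weights differ by at most `D` everywhere, then
`|𝒯_1(0,x) − 𝒯_2(0,x)| ≤ max(b_1/a_1, b_2/a_2)·D·|x|_1`. -/
theorem stmt17 {d : ℕ} (hd : 1 ≤ d) {a₁ b₁ a₂ b₂ : ℝ}
    (ha₁ : 0 < a₁) (h₁ : a₁ ≤ b₁) (ha₂ : 0 < a₂) (h₂ : a₂ ≤ b₂)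
    (τ₁ τ₂ : (Fin d → ℤ) → (Fin d → ℤ) → ℝ)
    (hτ₁ : ∀ y, ∀ α ∈ dirs d, a₁ ≤ τ₁ y α ∧ τ₁ y α ≤ b₁)
    (hτ₂ : ∀ y, ∀ α ∈ dirs d, a₂ ≤ τ₂ y α ∧ τ₂ y α ≤ b₂)
    (D : ℝ) (hD : 0 ≤ D)
    (hdist : ∀ y, ∀ α ∈ dirs d, |τ₁ y α - τ₂ y α| ≤ D)
    (x : Fin d → ℤ) :
    |fpt τ₁ 0 x - fpt τ₂ 0 x| ≤ max (b₁ / a₁) (b₂ / a₂) * D * zl1 x := by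
  have hx : 0 ≤ zl1 x := Finset.sum_nonneg fun i _ => abs_nonneg _
  have h12 := fpt_sub_fpt_le ha₂ (fun y α hα => ha₁.le.trans (hτ₁ y α hα).1) hτ₂ hD
    (fun y α hα => (abs_le.mp (hdist y α hα)).2) x
  have h21 := fpt_sub_fpt_le ha₁ (fun y α hα => ha₂.le.trans (hτ₂ y α hα).1) hτ₁ hD
    (fun y α hα => by linarith [(abs_le.mp (hdist y α hα)).1]) x
  rw [abs_sub_le_iff]
  refine ⟨h12.trans ?_, h21.trans ?_⟩
  · gcongr
    exact le_max_right _ _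
  · gcongr
    exact le_max_left _ _
end
end

section
/- Quantile coupling estimate: let 0 < a < b, ρ* > 0, and let F_1, F_2 : ℝ → ℝ be nondecreasing continuous functions with F_i = 0 on (−∞, a], F_i = 1 on [b, ∞), and satisfying F_i(r) − F_i(x) ≥ ρ*·(r − x) whenever a ≤ x ≤ r ≤ b (i = 1,2). Define the quantile functions Y_i(s) = inf{ x ∈ ℝ : F_i(x) ≥ s } for s ∈ (0,1]. Then for every s ∈ (0,1], |Y_1(s) − Y_2(s)| ≤ ( sup_{x∈ℝ} |F_1(x) − F_2(x)| ) / ρ*. -/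
noncomputable section

/-- A continuous function rising from `0` at `a` to `1` at `b`, with increments on `[a,b]` at least
`ρ` times the step, attains each level `s ∈ (0,1]` at its quantile. -/
theorem quantile_mem_Icc_and_apply_eq {a b ρ : ℝ} (hab : a ≤ b) (hρ : 0 < ρ) {F : ℝ → ℝ}
    (hcont : ContinuousOn F (Set.Icc a b)) (hlo : ∀ x ≤ a, F x = 0) (hhi : F b = 1)
    (hgrow : ∀ x r, a ≤ x → x ≤ r → r ≤ b → ρ * (r - x) ≤ F r - F x)
    {s : ℝ} (hs : s ∈ Set.Ioc (0 : ℝ) 1) :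
    sInf {x : ℝ | s ≤ F x} ∈ Set.Icc a b ∧ F (sInf {x : ℝ | s ≤ F x}) = s := by
  obtain ⟨x, hx, hFx⟩ : s ∈ F '' Set.Icc a b := by
    apply intermediate_value_Icc hab hcont
    rw [hlo a le_rfl, hhi]
    exact ⟨hs.1.le, hs.2⟩
  have hleast : IsLeast {x : ℝ | s ≤ F x} x := by
    refine ⟨hFx.ge, fun z (hz : s ≤ F z) => ?_⟩
    by_contra! hzx
    have haz : a ≤ z := by
      by_contra! hza
      linarith [hlo z hza.le, hs.1]
    linarith [hgrow z x haz hzx.le hx.2, mul_pos hρ (sub_pos.2 hzx)]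
  rw [hleast.csInf_eq]
  exact ⟨hx, hFx⟩

/-- quantile coupling estimate. For two CDFs supported in `[a,b]` whose
increments on `[a,b]` grow at rate at least `ρ*`, the quantile functions satisfy
`|Y_1(s) − Y_2(s)| ≤ sup_x |F_1(x) − F_2(x)| / ρ*` for all `s ∈ (0,1]`. -/
theorem stmt18 {a b ρ : ℝ} (ha : 0 < a) (hab : a < b) (hρ : 0 < ρ)
    (F₁ F₂ : ℝ → ℝ)
    (hmono₁ : Monotone F₁) (hmono₂ : Monotone F₂)
    (hcont₁ : Continuous F₁) (hcont₂ : Continuous F₂)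
    (hlo₁ : ∀ x ≤ a, F₁ x = 0) (hlo₂ : ∀ x ≤ a, F₂ x = 0)
    (hhi₁ : ∀ x, b ≤ x → F₁ x = 1) (hhi₂ : ∀ x, b ≤ x → F₂ x = 1)
    (hgrow₁ : ∀ x r, a ≤ x → x ≤ r → r ≤ b → ρ * (r - x) ≤ F₁ r - F₁ x)
    (hgrow₂ : ∀ x r, a ≤ x → x ≤ r → r ≤ b → ρ * (r - x) ≤ F₂ r - F₂ x)
    (s : ℝ) (hs : s ∈ Set.Ioc (0 : ℝ) 1) :
    |sInf {x : ℝ | s ≤ F₁ x} - sInf {x : ℝ | s ≤ F₂ x}|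
      ≤ (⨆ x : ℝ, |F₁ x - F₂ x|) / ρ := by
  obtain ⟨hy₁, hF₁⟩ :=
    quantile_mem_Icc_and_apply_eq hab.le hρ hcont₁.continuousOn hlo₁ (hhi₁ b le_rfl) hgrow₁ hs
  obtain ⟨hy₂, hF₂⟩ :=
    quantile_mem_Icc_and_apply_eq hab.le hρ hcont₂.continuousOn hlo₂ (hhi₂ b le_rfl) hgrow₂ hs
  set y₁ := sInf {x : ℝ | s ≤ F₁ x}
  set y₂ := sInf {x : ℝ | s ≤ F₂ x}
  have mem_unit {F : ℝ → ℝ} (hmono : Monotone F) (hlo : ∀ x ≤ a, F x = 0)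
      (hhi : ∀ x, b ≤ x → F x = 1) (x : ℝ) : 0 ≤ F x ∧ F x ≤ 1 :=
    ⟨(hlo _ (min_le_right x a)).ge.trans (hmono (min_le_left x a)),
      (hmono (le_max_left x b)).trans (hhi _ (le_max_right x b)).le⟩
  have hbdd : BddAbove (Set.range fun x : ℝ => |F₁ x - F₂ x|) := by
    refine ⟨1, Set.forall_mem_range.2 fun x => abs_le.2 ?_⟩
    obtain ⟨h₁, h₁'⟩ := mem_unit hmono₁ hlo₁ hhi₁ x
    obtain ⟨h₂, h₂'⟩ := mem_unit hmono₂ hlo₂ hhi₂ x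
    constructor <;> linarith
  rw [le_div_iff₀ hρ]
  rcases le_total y₁ y₂ with h | h
  · rw [abs_of_nonpos (sub_nonpos.2 h)]
    linarith [hgrow₂ y₁ y₂ hy₁.1 h hy₂.2, le_abs_self (F₁ y₁ - F₂ y₁), le_ciSup hbdd y₁]
  · rw [abs_of_nonneg (sub_nonneg.2 h)]
    linarith [hgrow₁ y₂ y₁ hy₂.1 h hy₁.2, neg_abs_le (F₁ y₂ - F₂ y₂), le_ciSup hbdd y₂]
end
end
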